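/- arXiv:1404.4812 — 2 statements merged into one kernel-verified Lean document; each statement's English description precedes it below -/
import Mathlib

section
/- Let P be a joint distribution on the n-party Bell scenario with all outcome sets finite and nonempty. Then the following are equivalent. (1) There exist dimensions d_i, d'_i ≥ 1 for i = 1, …, n, positive semidefinite matrices ρ_{o_s} indexed by ∏_i Fin(d_i) with ∑_{o_s} tr(ρ_{o_s}) = 1, positive semidefinite matrices σ_{o_{x_i}} ∈ M_{d'_i}(ℂ) with ∑_{o_{x_i}} tr(σ_{o_{x_i}}) = 1 for each i, and positive semidefinite matrices M_{o_{a_i}} indexed by Fin(d'_i) × Fin(d_i) with ∑_{o_{a_i}} M_{o_{a_i}} equal to the identity for each i, such that for every joint outcome o: P(o) = tr(S_o · T_o), where S_o and T_o are the matrices indexed by ∏_i (Fin(d'_i) × Fin(d_i)) with entries S_o[((c_i,b_i))_i, ((c'_i,b'_i))_i] = ρ_{o_s}[(b_i)_i, (b'_i)_i] · ∏_i σ_{o_{x_i}}[c_i, c'_i] and T_o[((c_i,b_i))_i, ((c'_i,b'_i))_i] = ∏_i M_{o_{a_i}}[(c_i,b_i), (c'_i,b'_i)]. (2) There exist dimensions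 m_i ≥ 1, unit vectors ψ_{o_s} ∈ ℂ^{∏_i Fin(m_i)}, and positive semidefinite matrices E^{o_{x_i}}_{o_{a_i}} ∈ M_{m_i}(ℂ) with ∑_{o_{a_i}} E^{o_{x_i}}_{o_{a_i}} equal to the identity for each i and o_{x_i}, such that for every joint outcome o: P(o) = ⟨ψ_{o_s}, F_o ψ_{o_s}⟩ · (∏_i P_{x_i}(o_{x_i})) · P_s(o_s), where F_o is the matrix indexed by ∏_i Fin(m_i) with entries F_o[(b_i)_i, (b'_i)_i] = ∏_i E^{o_{x_i}}_{o_{a_i}}[b_i, b'_i], and P_{x_i}, P_s denote the single-node marginals of P. -/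
/-- Nodes of the `n`-party Bell scenario: a source `s`, settings `x i` and outcomes `a i`. -/
inductive BellNode (n : ℕ) where
  | s : BellNode n
  | x : Fin n → BellNode n
  | a : Fin n → BellNode n
  deriving DecidableEq, Fintype

open Classical in
/-- The marginal of a joint distribution `P` on the set of nodes `U`. -/
noncomputable def marginal {V : Type} [Fintype V] [DecidableEq V] {O : V → Type}
    [∀ v, Fintype (O v)] (P : ((v : V) → O v) → ℝ) (U : Set V)
    (f : (v : V) → O v) : ℝ :=
  ∑ o : (v : V) → O v, if ∀ v ∈ U, o v = f v then P o else 0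

open scoped ComplexOrder in
/-- A positive semidefinite matrix is its trace times a density matrix. -/
lemma Matrix.PosSemidef.exists_eq_trace_smul {I : Type*} [Fintype I] [DecidableEq I] [Nonempty I]
    {A : Matrix I I ℂ} (hA : A.PosSemidef) :
    ∃ B : Matrix I I ℂ, B.PosSemidef ∧ B.trace = 1 ∧ A = A.trace • B := by
  by_cases h : A.trace = 0
  · refine ⟨((Fintype.card I : ℂ)⁻¹) • 1, Matrix.PosSemidef.one.smul ?_, ?_, ?_⟩
    · exact inv_nonneg.mpr (Nat.cast_nonneg _)
    · simp [Matrix.trace_smul]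
    · rw [h, zero_smul]
      exact hA.trace_eq_zero_iff.mp h
  · refine ⟨A.trace⁻¹ • A, hA.smul (inv_nonneg.mpr hA.trace_nonneg), ?_, ?_⟩
    · simp [Matrix.trace_smul, h]
    · rw [smul_smul, mul_inv_cancel₀ h, one_smul]

/-- The partial trace of `(σ ⊗ 1) M` over the first tensor factor. -/
def partialContract {B C : Type*} [Fintype C] (σ : Matrix C C ℂ) (M : Matrix (C × B) (C × B) ℂ) :
    Matrix B B ℂ :=
  Matrix.of fun b' b => ∑ c, ∑ c', σ c c' * M (c', b') (c, b)

lemma partialContract_smul {B C : Type*} [Fintype C] (t : ℂ) (σ : Matrix C C ℂ)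
    (M : Matrix (C × B) (C × B) ℂ) : partialContract (t • σ) M = t • partialContract σ M := by
  ext b' b
  simp [partialContract, Finset.mul_sum, mul_assoc]

lemma sum_partialContract {B C A : Type*} [Fintype C] [Fintype A] (σ : Matrix C C ℂ)
    (M : A → Matrix (C × B) (C × B) ℂ) :
    ∑ a, partialContract σ (M a) = partialContract σ (∑ a, M a) := by
  ext b' b
  simp only [partialContract, Matrix.sum_apply, Matrix.of_apply, Finset.mul_sum]
  rw [Finset.sum_comm]
  exact Finset.sum_congr rfl fun c _ => Finset.sum_comm

lemma partialContract_one {B C : Type*} [Fintype C] [DecidableEq B] [DecidableEq C]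
    (σ : Matrix C C ℂ) :
    partialContract σ (1 : Matrix (C × B) (C × B) ℂ) = σ.trace • (1 : Matrix B B ℂ) := by
  ext b' b
  by_cases h : b' = b <;>
    simp [partialContract, Matrix.one_apply, h, Matrix.trace]

open scoped ComplexOrder in
lemma partialContract_posSemidef {B C : Type*} [Fintype B] [Fintype C]
    {σ : Matrix C C ℂ} {M : Matrix (C × B) (C × B) ℂ} (hσ : σ.PosSemidef) (hM : M.PosSemidef) :
    (partialContract σ M).PosSemidef := by
  classical
  obtain ⟨m, v, rfl⟩ := Matrix.posSemidef_iff_eq_sum_vecMulVec.mp hσ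
  have key : partialContract (∑ k, Matrix.vecMulVec (v k) (star (v k))) M =
      ∑ k, (Matrix.of fun (b : B) (p : C × B) => if b = p.2 then star (v k p.1) else 0) * M *
        (Matrix.of fun (b : B) (p : C × B) =>
          if b = p.2 then star (v k p.1) else 0).conjTranspose := by
    ext b' b
    simp only [partialContract, Matrix.of_apply, Matrix.sum_apply, Matrix.mul_apply,
      Fintype.sum_prod_type, Matrix.conjTranspose_apply, Matrix.vecMulVec_apply, Pi.star_apply,
      ite_mul, zero_mul, apply_ite star, star_star, star_zero, mul_ite, mul_zero,
      Finset.sum_ite_eq, Finset.mem_univ, if_true, Finset.sum_mul]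
    conv_lhs => enter [2, c]; rw [Finset.sum_comm]
    rw [Finset.sum_comm]
    refine Finset.sum_congr rfl fun k _ => Finset.sum_congr rfl fun c _ =>
      Finset.sum_congr rfl fun c' _ => by ring
  rw [key]
  exact Matrix.posSemidef_sum _ fun k _ => hM.mul_mul_conjTranspose_same _

/-- A sum over tuples of pairs is an iterated sum over pairs of tuples. -/
lemma sum_pi_prod {ι R : Type*} [Fintype ι] [DecidableEq ι] [AddCommMonoid R] {C B : ι → Type*}
    [∀ i, Fintype (C i)] [∀ i, Fintype (B i)] (f : (∀ i, C i) → (∀ i, B i) → R) :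
    ∑ q : (i : ι) → C i × B i, f (fun i => (q i).1) (fun i => (q i).2) = ∑ c, ∑ b, f c b := by
  rw [← Fintype.sum_prod_type']
  exact Fintype.sum_equiv (Equiv.arrowProdEquivProdArrow ι C B) _ _ fun _ => rfl

/-- The trace pairing of a product of setting states with a product of measurement operators,
with the setting systems traced out. -/
lemma trace_mul_eq_sum_partialContract {ι : Type*} [Fintype ι] [DecidableEq ι] {C B : ι → Type*}
    [∀ i, Fintype (C i)] [∀ i, Fintype (B i)]
    (ρ : Matrix (∀ i, B i) (∀ i, B i) ℂ) (σ : ∀ i, Matrix (C i) (C i) ℂ)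
    (M : ∀ i, Matrix (C i × B i) (C i × B i) ℂ) :
    Matrix.trace
      ((Matrix.of fun cb cb' : (i : ι) → C i × B i =>
          ρ (fun i => (cb i).2) (fun i => (cb' i).2) * ∏ i, σ i (cb i).1 (cb' i).1)
        * (Matrix.of fun cb cb' : (i : ι) → C i × B i => ∏ i, M i (cb i) (cb' i)))
    = ∑ b, ∑ b', ρ b b' * ∏ i, partialContract (σ i) (M i) (b' i) (b i) := by
  simp only [Matrix.trace, Matrix.diag, Matrix.mul_apply, Matrix.of_apply]
  have h1 := sum_pi_prod (ι := ι) (C := C) (B := B) fun c b =>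
    ∑ q : (i : ι) → C i × B i, ρ b (fun i => (q i).2) * (∏ i, σ i (c i) (q i).1) *
      ∏ i, M i (q i) (c i, b i)
  refine h1.trans ?_
  have h2 := fun (c : ∀ i, C i) (b : ∀ i, B i) => sum_pi_prod (ι := ι) (C := C) (B := B)
    fun c' b' => ρ b b' * (∏ i, σ i (c i) (c' i)) * ∏ i, M i (c' i, b' i) (c i, b i)
  rw [Finset.sum_congr rfl fun c _ => Finset.sum_congr rfl fun b _ => h2 c b]
  simp only [partialContract, Matrix.of_apply, Fintype.prod_sum, Finset.mul_sum]
  rw [Finset.sum_comm]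
  refine Finset.sum_congr rfl fun b _ => ?_
  rw [Finset.sum_comm' (t' := Finset.univ) (s' := fun _ => Finset.univ) (by simp)]
  conv_rhs => rw [Finset.sum_comm]
  conv_lhs => rw [Finset.sum_comm]
  refine Finset.sum_congr rfl fun c _ => ?_
  rw [Finset.sum_comm]
  refine Finset.sum_congr rfl fun b' _ => Finset.sum_congr rfl fun c' _ => ?_
  rw [Finset.prod_mul_distrib, mul_assoc]

/-- Outcomes of the Bell scenario, split by kind of node. -/
def bellEquiv {n : ℕ} (O : BellNode n → Type) :
    ((v : BellNode n) → O v) ≃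
      O BellNode.s × ((i : Fin n) → O (BellNode.x i) × O (BellNode.a i)) where
  toFun o := (o BellNode.s, fun i => (o (BellNode.x i), o (BellNode.a i)))
  invFun q v := match v with
    | .s => q.1
    | .x i => (q.2 i).1
    | .a i => (q.2 i).2
  left_inv o := by ext v; cases v <;> rfl
  right_inv q := rfl

/-- Reweighting a product-form distribution on the source and on the settings. -/
lemma sum_weighted_bell {n : ℕ} {O : BellNode n → Type} [∀ v, Fintype (O v)]
    {B : Fin n → Type*} [∀ i, Fintype (B i)] [∀ i, DecidableEq (B i)]
    (Q : ((v : BellNode n) → O v) → ℂ)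
    (ρ : O BellNode.s → Matrix (∀ i, B i) (∀ i, B i) ℂ)
    (G : (i : Fin n) → O (BellNode.x i) → O (BellNode.a i) → Matrix (B i) (B i) ℂ)
    (t : (i : Fin n) → O (BellNode.x i) → ℂ)
    (hG : ∀ i x, ∑ a, G i x a = t i x • 1)
    (hQ : ∀ o, Q o = ∑ b, ∑ b', ρ (o BellNode.s) b b' *
      ∏ i, G i (o (BellNode.x i)) (o (BellNode.a i)) (b' i) (b i))
    (u : O BellNode.s → ℂ) (w : (i : Fin n) → O (BellNode.x i) → ℂ) :
    ∑ o, u (o BellNode.s) * (∏ i, w i (o (BellNode.x i))) * Q o =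
      (∑ s, u s * (ρ s).trace) * ∏ i, ∑ x, w i x * t i x := by
  classical
  have hpt (b b' : ∀ i, B i) :
      ∑ q : (i : Fin n) → O (BellNode.x i) × O (BellNode.a i),
        ∏ i, (w i (q i).1 * G i (q i).1 (q i).2 (b' i) (b i)) =
      if b' = b then ∏ i, ∑ x, w i x * t i x else 0 := by
    rw [← Fintype.prod_sum fun i (p : O (BellNode.x i) × O (BellNode.a i)) =>
      w i p.1 * G i p.1 p.2 (b' i) (b i)]
    have (i : Fin n) : ∑ p : O (BellNode.x i) × O (BellNode.a i),
        w i p.1 * G i p.1 p.2 (b' i) (b i) =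
        if b' i = b i then ∑ x, w i x * t i x else 0 := by
      rw [Fintype.sum_prod_type]
      simp only [← Finset.mul_sum, ← Matrix.sum_apply, hG]
      by_cases h : b' i = b i <;> simp [h]
    simp only [this]
    by_cases h : b' = b
    · simp [h]
    · obtain ⟨i, hi⟩ := Function.ne_iff.mp h
      rw [if_neg h]
      exact Finset.prod_eq_zero (Finset.mem_univ i) (if_neg hi)
  have hsplit : ∑ o, u (o BellNode.s) * (∏ i, w i (o (BellNode.x i))) * Q o =
      ∑ s, ∑ q : (i : Fin n) → O (BellNode.x i) × O (BellNode.a i),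
        u s * (∏ i, w i (q i).1) *
          ∑ b, ∑ b', ρ s b b' * ∏ i, G i (q i).1 (q i).2 (b' i) (b i) := by
    rw [← Fintype.sum_prod_type']
    exact Fintype.sum_equiv (bellEquiv O) _ _ fun o => by rw [hQ]; rfl
  rw [hsplit, Finset.sum_mul]
  refine Finset.sum_congr rfl fun s _ => ?_
  calc _ = ∑ b, ∑ b', u s * ρ s b b' *
        ∑ q : (i : Fin n) → O (BellNode.x i) × O (BellNode.a i),
          ∏ i, (w i (q i).1 * G i (q i).1 (q i).2 (b' i) (b i)) := by
        simp only [Finset.mul_sum]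
        rw [Finset.sum_comm]
        refine Finset.sum_congr rfl fun b _ => ?_
        rw [Finset.sum_comm]
        refine Finset.sum_congr rfl fun b' _ => Finset.sum_congr rfl fun q _ => ?_
        rw [Finset.prod_mul_distrib]
        ring
    _ = _ := by
        simp only [hpt, mul_ite, mul_zero, Finset.sum_ite_eq', Finset.mem_univ, if_true,
          Matrix.trace, Matrix.diag, Finset.mul_sum, Finset.sum_mul]

lemma marginal_singleton {V : Type} [Fintype V] [DecidableEq V] {O : V → Type}
    [∀ v, Fintype (O v)] [∀ v, DecidableEq (O v)] (P : ((v : V) → O v) → ℝ) (v : V)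
    (f : (v : V) → O v) :
    marginal P {v} f = ∑ o, if o v = f v then P o else 0 := by
  unfold marginal
  exact Finset.sum_congr rfl fun o _ => by simp

/-- The quadratic form of local operators in the purification `∑ R b e |b e⟩` of `R * Rᴴ`. -/
lemma purification_dotProduct {ι : Type*} [Fintype ι] [DecidableEq ι] {N B : ι → Type*}
    [∀ i, Fintype (N i)] [∀ i, Fintype (B i)] [∀ i, DecidableEq (B i)]
    (e : ∀ i, N i ≃ B i × B i) (R : Matrix (∀ i, B i) (∀ i, B i) ℂ)
    (E : ∀ i, Matrix (B i) (B i) ℂ) :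
    dotProduct (star fun β : ∀ i, N i => R (fun i => (e i (β i)).1) (fun i => (e i (β i)).2))
      (Matrix.mulVec
        (Matrix.of fun β β' : ∀ i, N i =>
          ∏ i, ((Matrix.kronecker (E i) (1 : Matrix (B i) (B i) ℂ)).submatrix (e i) (e i))
            (β i) (β' i))
        (fun β : ∀ i, N i => R (fun i => (e i (β i)).1) (fun i => (e i (β i)).2)))
    = ∑ b, ∑ b', (R * R.conjTranspose) b b' * ∏ i, E i (b' i) (b i) := by
  have hsum (f : (∀ i, B i) → (∀ i, B i) → ℂ) :
      ∑ β : ∀ i, N i, f (fun i => (e i (β i)).1) (fun i => (e i (β i)).2) = ∑ c, ∑ b, f c b := by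
    rw [← sum_pi_prod]
    exact Fintype.sum_equiv (Equiv.piCongrRight e) _ _ fun _ => rfl
  have hprod (b k b' k' : ∀ i, B i) :
      ∏ i, E i (b i) (b' i) * (1 : Matrix (B i) (B i) ℂ) (k i) (k' i) =
        if k = k' then ∏ i, E i (b i) (b' i) else 0 := by
    by_cases h : k = k'
    · subst h
      simp
    · obtain ⟨i, hi⟩ := Function.ne_iff.mp h
      rw [if_neg h]
      exact Finset.prod_eq_zero (Finset.mem_univ i) (by simp [hi])
  simp only [dotProduct, Matrix.mulVec, Matrix.of_apply, Pi.star_apply, Matrix.submatrix_apply,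
    Matrix.kronecker, Matrix.kroneckerMap_apply]
  refine (hsum fun b k => star (R b k) * ∑ β' : ∀ i, N i,
    (∏ i, E i (b i) (e i (β' i)).1 * (1 : Matrix (B i) (B i) ℂ) (k i) (e i (β' i)).2) *
      R (fun i => (e i (β' i)).1) (fun i => (e i (β' i)).2)).trans ?_
  rw [Finset.sum_congr rfl fun b _ => Finset.sum_congr rfl fun k _ => congrArg _ <|
    hsum fun b' k' => (∏ i, E i (b i) (b' i) * (1 : Matrix (B i) (B i) ℂ) (k i) (k' i)) * R b' k']
  simp only [hprod, ite_mul, zero_mul, Finset.sum_ite_eq, Finset.mem_univ, if_true,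
    Matrix.mul_apply, Matrix.conjTranspose_apply, Finset.mul_sum, Finset.sum_mul]
  conv_lhs => enter [2, b]; rw [Finset.sum_comm]
  rw [Finset.sum_comm]
  exact Finset.sum_congr rfl fun b' _ => Finset.sum_congr rfl fun b _ =>
    Finset.sum_congr rfl fun k _ => by ring

lemma purification_norm {ι : Type*} [Fintype ι] [DecidableEq ι] {N B : ι → Type*}
    [∀ i, Fintype (N i)] [∀ i, Fintype (B i)]
    (e : ∀ i, N i ≃ B i × B i) (R : Matrix (∀ i, B i) (∀ i, B i) ℂ) :
    dotProduct (star fun β : ∀ i, N i => R (fun i => (e i (β i)).1) (fun i => (e i (β i)).2))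
      (fun β : ∀ i, N i => R (fun i => (e i (β i)).1) (fun i => (e i (β i)).2))
    = (R * R.conjTranspose).trace := by
  simp only [dotProduct, Matrix.trace, Matrix.diag, Matrix.mul_apply, Matrix.conjTranspose_apply,
    Pi.star_apply]
  rw [← sum_pi_prod (ι := ι) (C := B) (B := B) fun b k => R b k * star (R b k)]
  exact Fintype.sum_equiv (Equiv.piCongrRight e) _ _ fun _ => mul_comm _ _

open scoped ComplexOrder in
lemma Matrix.PosSemidef.exists_eq_mul_conjTranspose {I : Type*} [Fintype I] [DecidableEq I]
    {A : Matrix I I ℂ} (hA : A.PosSemidef) : ∃ R : Matrix I I ℂ, A = R * R.conjTranspose := by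
  open scoped MatrixOrder in
  obtain ⟨R, hR⟩ := CStarAlgebra.nonneg_iff_eq_mul_star_self.mp hA.nonneg
  exact ⟨R, hR⟩

lemma sum_marginal_singleton {V : Type} [Fintype V] [DecidableEq V] {O : V → Type}
    [∀ v, Fintype (O v)] [∀ v, DecidableEq (O v)] (P : ((v : V) → O v) → ℝ) (v : V)
    (f : (v : V) → O v) :
    ∑ y, marginal P {v} (Function.update f v y) = ∑ o, P o := by
  simp only [marginal_singleton, Function.update_self]
  rw [Finset.sum_comm]
  simp

lemma marginal_nonneg {V : Type} [Fintype V] [DecidableEq V] {O : V → Type}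
    [∀ v, Fintype (O v)] {P : ((v : V) → O v) → ℝ} (hP : ∀ o, 0 ≤ P o) (U : Set V)
    (f : (v : V) → O v) : 0 ≤ marginal P U f :=
  Finset.sum_nonneg fun o _ => by split_ifs <;> simp [hP]

/-- The measurement that reads a classical setting `x`, encoded in the standard basis, and then
measures `E x`. -/
def controlledOp {X C B : Type*} [DecidableEq C] (e : X ≃ C) (E : X → Matrix B B ℂ) :
    Matrix (C × B) (C × B) ℂ :=
  Matrix.of fun p q => if p.1 = q.1 then E (e.symm p.1) p.2 q.2 else 0

open scoped ComplexOrder in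
lemma controlledOp_posSemidef {X C B : Type*} [Fintype B] [Fintype C]
    [DecidableEq C] (e : X ≃ C) {E : X → Matrix B B ℂ}
    (hE : ∀ x, (E x).PosSemidef) : (controlledOp e E).PosSemidef := by
  classical
  have key : controlledOp e E =
      ∑ c, Matrix.kronecker (Matrix.single c c 1) (E (e.symm c)) := by
    ext ⟨c, b⟩ ⟨c', b'⟩
    simp [controlledOp, Matrix.sum_apply, Matrix.kronecker, Matrix.kroneckerMap_apply,
      Matrix.single_apply, ite_and]
  rw [key]
  refine Matrix.posSemidef_sum _ fun c _ => Matrix.PosSemidef.kronecker ?_ (hE _)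
  rw [← Matrix.diagonal_single]
  refine Matrix.PosSemidef.diagonal ?_
  exact Pi.single_nonneg.mpr zero_le_one

lemma sum_controlledOp {X C B A : Type*} [Fintype A] [DecidableEq B] [DecidableEq C]
    (e : X ≃ C) (E : X → A → Matrix B B ℂ)
    (hE : ∀ x, ∑ a, E x a = 1) : ∑ a, controlledOp e (fun x => E x a) = 1 := by
  ext ⟨c, b⟩ ⟨c', b'⟩
  by_cases h : c = c'
  · subst h
    simp only [controlledOp, Matrix.sum_apply, Matrix.of_apply, if_true]
    simp only [← Matrix.sum_apply, hE, Matrix.one_apply, Prod.mk.injEq, true_and]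
  · simp [controlledOp, Matrix.sum_apply, h]

lemma partialContract_controlledOp {X C B : Type*} [Fintype C]
    [DecidableEq C] (e : X ≃ C) (E : X → Matrix B B ℂ) (y : X) (p : ℂ) :
    partialContract (Matrix.single (e y) (e y) p) (controlledOp e E) = p • E y := by
  ext b' b
  simp [partialContract, controlledOp, Matrix.single_apply, ite_and]

open scoped ComplexOrder in
theorem statement_11 {n : ℕ} {O : BellNode n → Type}
    [∀ v, Fintype (O v)] [∀ v, Nonempty (O v)]
    (P : ((v : BellNode n) → O v) → ℝ) (hP0 : ∀ o, 0 ≤ P o) (hP1 : ∑ o, P o = 1) :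
    -- (1) operational quantum model: subnormalized states at the source and at the
    -- setting nodes, and POVMs at the measurement nodes
    (∃ (d d' : Fin n → ℕ), (∀ i, 1 ≤ d i) ∧ (∀ i, 1 ≤ d' i) ∧
      ∃ (ρ : O BellNode.s → Matrix ((i : Fin n) → Fin (d i)) ((i : Fin n) → Fin (d i)) ℂ)
        (σ : (i : Fin n) → O (BellNode.x i) → Matrix (Fin (d' i)) (Fin (d' i)) ℂ)
        (M : (i : Fin n) → O (BellNode.a i) →
          Matrix (Fin (d' i) × Fin (d i)) (Fin (d' i) × Fin (d i)) ℂ),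
        (∀ os, (ρ os).PosSemidef) ∧ (∑ os, (ρ os).trace = 1) ∧
        (∀ i ox, (σ i ox).PosSemidef) ∧ (∀ i, ∑ ox, (σ i ox).trace = 1) ∧
        (∀ i oa, (M i oa).PosSemidef) ∧ (∀ i, ∑ oa, M i oa = 1) ∧
        (∀ o : (v : BellNode n) → O v,
          (P o : ℂ) = Matrix.trace
            ((Matrix.of fun cb cb' : (i : Fin n) → Fin (d' i) × Fin (d i) =>
                ρ (o BellNode.s) (fun i => (cb i).2) (fun i => (cb' i).2)
                  * ∏ i, σ i (o (BellNode.x i)) (cb i).1 (cb' i).1)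
              * (Matrix.of fun cb cb' : (i : Fin n) → Fin (d' i) × Fin (d i) =>
                  ∏ i, M i (o (BellNode.a i)) (cb i) (cb' i)))))
    ↔
    -- (2) standard quantum model: a family of pure states and POVMs indexed by settings
    (∃ (m : Fin n → ℕ), (∀ i, 1 ≤ m i) ∧
      ∃ (ψ : O BellNode.s → ((i : Fin n) → Fin (m i)) → ℂ)
        (Eop : (i : Fin n) → O (BellNode.x i) → O (BellNode.a i) →
          Matrix (Fin (m i)) (Fin (m i)) ℂ),
        (∀ os, dotProduct (star (ψ os)) (ψ os) = 1) ∧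
        (∀ i ox oa, (Eop i ox oa).PosSemidef) ∧
        (∀ i ox, ∑ oa, Eop i ox oa = 1) ∧
        (∀ o : (v : BellNode n) → O v,
          (P o : ℂ) =
            (dotProduct (star (ψ (o BellNode.s)))
              (Matrix.mulVec
                (Matrix.of fun b b' : (i : Fin n) → Fin (m i) =>
                  ∏ i, Eop i (o (BellNode.x i)) (o (BellNode.a i)) (b i) (b' i))
                (ψ (o BellNode.s))))
            * (∏ i, (marginal P {BellNode.x i} o : ℂ))
            * (marginal P {BellNode.s} o : ℂ))) := by
  classical
  constructor
  · rintro ⟨d, d', hd, hd', ρ, σ, M, hρ, hρ1, hσ, hσ1, hM, hM1, hP⟩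
    have hne (i : Fin n) : Nonempty (Fin (d i)) := ⟨⟨0, hd i⟩⟩
    have hne' (i : Fin n) : Nonempty (Fin (d' i)) := ⟨⟨0, hd' i⟩⟩
    choose ρ' hρ' hρ'1 hρρ' using fun s => (hρ s).exists_eq_trace_smul
    choose R hR using fun s => (hρ' s).exists_eq_mul_conjTranspose
    choose σ' hσ' hσ'1 hσσ' using fun i x => (hσ i x).exists_eq_trace_smul
    have hP' (o : (v : BellNode n) → O v) : (P o : ℂ) =
        ∑ b, ∑ b', ρ (o BellNode.s) b b' * ∏ i,
          partialContract (σ i (o (BellNode.x i))) (M i (o (BellNode.a i))) (b' i) (b i) :=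
      (hP o).trans (trace_mul_eq_sum_partialContract _ _ _)
    have hw := sum_weighted_bell (fun o => (P o : ℂ)) ρ
      (fun i x a => partialContract (σ i x) (M i a)) (fun i x => (σ i x).trace)
      (fun i x => by rw [sum_partialContract, hM1, partialContract_one]) hP'
    have hs (o : (v : BellNode n) → O v) :
        (marginal P {BellNode.s} o : ℂ) = (ρ (o BellNode.s)).trace := by
      have := hw (fun s => if s = o BellNode.s then 1 else 0) (fun _ _ => 1)
      simp only [one_mul, hσ1, Finset.prod_const_one, mul_one, ite_mul, zero_mul,
        Finset.sum_ite_eq', Finset.mem_univ, if_true] at this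
      rw [marginal_singleton, ← this]
      simp only [Complex.ofReal_sum, apply_ite Complex.ofReal, Complex.ofReal_zero]
    have hx (o : (v : BellNode n) → O v) (i : Fin n) :
        (marginal P {BellNode.x i} o : ℂ) = (σ i (o (BellNode.x i))).trace := by
      have := hw (fun _ => 1)
        (fun j x => if j = i then (if x = o (BellNode.x j) then 1 else 0) else 1)
      rw [Finset.prod_eq_single i (fun j _ hj => by simp [hj, hσ1]) (by simp)] at this
      simp only [one_mul, hρ1, ite_mul, zero_mul, Finset.prod_ite_eq', Finset.sum_ite_eq',
        Finset.mem_univ, if_true] at this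
      rw [marginal_singleton, ← this]
      simp only [Complex.ofReal_sum, apply_ite Complex.ofReal, Complex.ofReal_zero]
    refine ⟨fun i => d i * d i, fun i => Nat.mul_pos (hd i) (hd i),
      fun s β => R s (fun i => (finProdFinEquiv.symm (β i)).1)
        (fun i => (finProdFinEquiv.symm (β i)).2),
      fun i x a => (Matrix.kronecker (partialContract (σ' i x) (M i a)) 1).submatrix
        finProdFinEquiv.symm finProdFinEquiv.symm, ?_, ?_, ?_, ?_⟩
    · intro s
      refine (purification_norm (fun i : Fin n => finProdFinEquiv.symm) (R s)).trans ?_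
      rw [← hR, hρ'1]
    · intro i x a
      exact ((partialContract_posSemidef (hσ' i x) (hM i a)).kronecker
        Matrix.PosSemidef.one).submatrix _
    · intro i x
      have := sum_partialContract (σ' i x) (M i)
      rw [hM1, partialContract_one, hσ'1, one_smul] at this
      ext β β'
      simp only [Matrix.sum_apply, Matrix.submatrix_apply, Matrix.kronecker,
        Matrix.kroneckerMap_apply]
      rw [← Finset.sum_mul, ← Matrix.sum_apply, this]
      have h : Matrix.kronecker 1 1 (finProdFinEquiv.symm β) (finProdFinEquiv.symm β') =
          (1 : Matrix (Fin (d i * d i)) (Fin (d i * d i)) ℂ) β β' := by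
        rw [Matrix.kronecker, Matrix.one_kronecker_one]
        simp only [Matrix.one_apply, finProdFinEquiv.symm.injective.eq_iff]
      exact h
    · intro o
      rw [hs, purification_dotProduct (fun i : Fin n => finProdFinEquiv.symm), ← hR, hP']
      simp only [hx, Finset.sum_mul]
      refine Finset.sum_congr rfl fun b _ => Finset.sum_congr rfl fun b' _ => ?_
      have h1 : ∏ i, partialContract (σ i (o (BellNode.x i))) (M i (o (BellNode.a i))) (b' i) (b i)
          = (∏ i, (σ i (o (BellNode.x i))).trace) *
            ∏ i, partialContract (σ' i (o (BellNode.x i))) (M i (o (BellNode.a i)))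
              (b' i) (b i) := by
        rw [← Finset.prod_mul_distrib]
        refine Finset.prod_congr rfl fun i _ => ?_
        conv_lhs => rw [hσσ' i (o (BellNode.x i)), partialContract_smul]
        rfl
      have h2 : ρ (o BellNode.s) b b' = (ρ (o BellNode.s)).trace * ρ' (o BellNode.s) b b' := by
        conv_lhs => rw [hρρ' (o BellNode.s)]
        rfl
      rw [h1, h2]
      ring
  · rintro ⟨m, hm, ψ, E, hψ, hE, hE1, hP⟩
    let o₀ : (v : BellNode n) → O v := fun v => Classical.arbitrary (O v)
    let p (v : BellNode n) (y : O v) : ℝ := marginal P {v} (Function.update o₀ v y)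
    have hp0 (v : BellNode n) (y : O v) : (0 : ℂ) ≤ (p v y : ℂ) :=
      Complex.zero_le_real.mpr (marginal_nonneg hP0 _ _)
    have hp1 (v : BellNode n) : ∑ y, (p v y : ℂ) = 1 := by
      have := (sum_marginal_singleton P v o₀).trans hP1
      exact_mod_cast this
    have hp (v : BellNode n) (o : (v : BellNode n) → O v) : marginal P {v} o = p v (o v) := by
      simp [p, marginal_singleton]
    let e (i : Fin n) := Fintype.equivFin (O (BellNode.x i))
    refine ⟨m, fun i => Fintype.card (O (BellNode.x i)), hm, fun i => Fintype.card_pos,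
      fun s => (p BellNode.s s : ℂ) • Matrix.vecMulVec (ψ s) (star (ψ s)),
      fun i x => Matrix.single (e i x) (e i x) (p (BellNode.x i) x : ℂ),
      fun i a => controlledOp (e i) fun x => E i x a, ?_, ?_, ?_, ?_, ?_, ?_, ?_⟩
    · exact fun s => (Matrix.posSemidef_vecMulVec_self_star _).smul (hp0 _ _)
    · simp only [Matrix.trace_smul, Matrix.trace_vecMulVec, dotProduct_comm (ψ _), hψ,
        smul_eq_mul, mul_one, hp1]
    · intro i x
      beta_reduce
      rw [← Matrix.diagonal_single]
      exact Matrix.PosSemidef.diagonal (Pi.single_nonneg.mpr (hp0 _ _))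
    · intro i
      simp [hp1]
    · exact fun i a => controlledOp_posSemidef _ fun x => hE i x a
    · exact fun i => sum_controlledOp _ _ (hE1 i)
    · intro o
      rw [trace_mul_eq_sum_partialContract, hP]
      simp only [partialContract_controlledOp, hp, dotProduct, Matrix.mulVec, Matrix.of_apply,
        Matrix.smul_apply, Matrix.vecMulVec_apply, Pi.star_apply, smul_eq_mul, Finset.mul_sum,
        Finset.sum_mul, Finset.prod_mul_distrib]
      rw [Finset.sum_comm]
      refine Finset.sum_congr rfl fun b _ => Finset.sum_congr rfl fun b' _ => by ring
end

section
/- In the n-party Bell scenario, if a joint distribution P is a classical correlation with finite hidden variables, then P admits a finite-dimensional quantum model: there exist dimensions m_i ≥ 1, unit vectors ψ_{o_s} ∈ ℂ^{∏_i Fin(m_i)}, and positive semidefinite matrices E^{o_{x_i}}_{o_{a_i}} ∈ M_{m_i}(ℂ) with ∑_{o_{a_i}} E^{o_{x_i}}_{o_{a_i}} equal to the identity for each i and o_{x_i}, such that for every joint outcome o: P(o) = ⟨ψ_{o_s}, F_o ψ_{o_s}⟩ · (∏_i P_{x_i}(o_{x_i})) · P_s(o_s), where F_o is the matrix indexed by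 ∏_i Fin(m_i) with entries F_o[(b_i)_i, (b'_i)_i] = ∏_i E^{o_{x_i}}_{o_{a_i}}[b_i, b'_i], and P_{x_i}, P_s denote the single-node marginals of P. -/
/-- Edge set of the `n`-party Bell scenario: `s → a i` and `x i → a i` for each party `i`. -/
def BellEdges (n : ℕ) : Finset (BellNode n × BellNode n) :=
  (Finset.univ : Finset (Fin n)).biUnion fun i =>
    {(BellNode.s, BellNode.a i), (BellNode.x i, BellNode.a i)}

/-- The type of edges of a graph on node set `V` given by an edge set `E ⊆ V × V`. -/
abbrev EdgeT {V : Type} (E : Finset (V × V)) : Type := {p : V × V // p ∈ E}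

/-- The data `(X, p)` is a hidden-variable model realizing the joint distribution `P`. -/
def IsHVRealization {V : Type} [Fintype V] [DecidableEq V] (E : Finset (V × V))
    {O : V → Type} [∀ v, Fintype (O v)] (P : ((v : V) → O v) → ℝ)
    (X : EdgeT E → Type) [∀ e, Fintype (X e)]
    (p : (v : V) → O v → ((e : {e : EdgeT E // e.1.1 = v}) → X e.1)
        → ((e : {e : EdgeT E // e.1.2 = v}) → X e.1) → ℝ) : Prop :=
  (∀ v o μ lam, 0 ≤ p v o μ lam) ∧
  (∀ (v : V) (lam : (e : {e : EdgeT E // e.1.2 = v}) → X e.1),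
    ∑ o : O v, ∑ μ : (e : {e : EdgeT E // e.1.1 = v}) → X e.1, p v o μ lam = 1) ∧
  (∀ o : (v : V) → O v,
    P o = ∑ lam : (e : EdgeT E) → X e,
      ∏ v, p v (o v) (fun e => lam e.1) (fun e => lam e.1))

/-- `P` is a classical correlation with finite hidden variables on the graph `(V, E)`. -/
def IsClassicalFinHV {V : Type} [Fintype V] [DecidableEq V] (E : Finset (V × V))
    {O : V → Type} [∀ v, Fintype (O v)] (P : ((v : V) → O v) → ℝ) : Prop :=
  ∃ (X : EdgeT E → Type) (iX : ∀ e, Fintype (X e)) (_ : ∀ e, Nonempty (X e))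
    (p : (v : V) → O v → ((e : {e : EdgeT E // e.1.1 = v}) → X e.1)
        → ((e : {e : EdgeT E // e.1.2 = v}) → X e.1) → ℝ),
    @IsHVRealization V _ _ E O _ P X iX p

lemma exists_conditional {α β : Type*} [Fintype β] [Nonempty β] (k : α → β → ℝ)
    (hk : ∀ a b, 0 ≤ k a b) :
    ∃ K : α → β → ℝ, (∀ a b, 0 ≤ K a b) ∧ (∀ a, ∑ b, K a b = 1) ∧
      ∀ a b, k a b = (∑ b', k a b') * K a b := by
  refine ⟨fun a b => if ∑ b', k a b' = 0 then (Fintype.card β : ℝ)⁻¹ else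
    k a b / ∑ b', k a b', fun a b => ?_, fun a => ?_, fun a b => ?_⟩
  · dsimp only
    split_ifs
    · positivity
    · exact div_nonneg (hk a b) (Finset.sum_nonneg fun b _ => hk a b)
  · by_cases h : ∑ b', k a b' = 0
    · simp [h]
    · simp only [h, if_false]
      rw [← Finset.sum_div, div_self h]
  · by_cases h : ∑ b', k a b' = 0
    · rw [h, zero_mul]
      exact (Finset.sum_eq_zero_iff_of_nonneg fun b _ => hk a b).1 h b (Finset.mem_univ b)
    · simp only [h, if_false]
      field_simp

namespace BellNode

/-- A Bell scenario node is the source, a setting or an outcome. -/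
def equivSum (n : ℕ) : Unit ⊕ (Fin n ⊕ Fin n) ≃ BellNode n where
  toFun := Sum.elim (fun _ => s) (Sum.elim x a)
  invFun
    | s => Sum.inl ()
    | x i => Sum.inr (Sum.inl i)
    | a i => Sum.inr (Sum.inr i)
  left_inv := by rintro (_ | _ | _) <;> rfl
  right_inv := by rintro (_ | _ | _) <;> rfl

lemma prod_eq {n : ℕ} {M : Type*} [CommMonoid M] (g : BellNode n → M) :
    ∏ v, g v = g s * ((∏ i, g (x i)) * ∏ i, g (a i)) := by
  rw [← (equivSum n).prod_comp, Fintype.prod_sum_type, Fintype.prod_sum_type]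
  simp [equivSum]

/-- A joint outcome splits into the outcomes of the source, the settings and the parties. -/
def outcomeEquiv {n : ℕ} (O : BellNode n → Type*) :
    (∀ v, O v) ≃ O s × (∀ i, O (x i)) × (∀ i, O (a i)) where
  toFun o := (o s, fun i => o (x i), fun i => o (a i))
  invFun f
    | s => f.1
    | x i => f.2.1 i
    | a i => f.2.2 i
  left_inv o := by funext v; cases v <;> rfl
  right_inv _ := rfl

lemma sum_eq {n : ℕ} {O : BellNode n → Type*} [∀ v, Fintype (O v)]
    {M : Type*} [AddCommMonoid M] (g : O s → (∀ i, O (x i)) → (∀ i, O (a i)) → M) :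
    ∑ o : ∀ v, O v, g (o s) (fun i => o (x i)) (fun i => o (a i)) =
      ∑ os, ∑ ox, ∑ oa, g os ox oa := by
  refine ((outcomeEquiv O).sum_comp fun f => g f.1 f.2.1 f.2.2).trans ?_
  simp only [Fintype.sum_prod_type]

end BellNode

lemma sum_bell_eq {n : ℕ} {O : BellNode n → Type*} [∀ v, Fintype (O v)] {S : Fin n → Type*}
    [∀ i, Fintype (S i)] (Q : O .s → ℝ) (R : ∀ i, O (.x i) → ℝ)
    (K : O .s → (∀ i, S i) → ℝ) (hK : ∀ os, ∑ σ, K os σ = 1)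
    (W : ∀ i, O (.x i) → S i → O (.a i) → ℝ) (hW : ∀ i ox s, ∑ oa, W i ox s oa = 1) :
    ∑ o : ∀ v, O v, Q (o .s) * (∏ i, R i (o (.x i))) *
      ∑ σ, K (o .s) σ * ∏ i, W i (o (.x i)) (σ i) (o (.a i)) =
    (∑ os, Q os) * ∏ i, ∑ ox, R i ox := by
  have key : ∀ (os : O .s) (ox : ∀ i, O (.x i)), ∑ oa : ∀ i, O (.a i),
      ∑ σ, K os σ * ∏ i, W i (ox i) (σ i) (oa i) = 1 := by
    intro os ox
    rw [Finset.sum_comm]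
    simp_rw [← Finset.mul_sum]
    rw [← hK os]
    refine Finset.sum_congr rfl fun σ _ => ?_
    rw [← Fintype.piFinset_univ, ← Finset.prod_univ_sum]
    simp [hW]
  refine (BellNode.sum_eq fun os ox oa => Q os * (∏ i, R i (ox i)) *
    ∑ σ, K os σ * ∏ i, W i (ox i) (σ i) (oa i)).trans ?_
  simp_rw [← Finset.mul_sum, key, mul_one, ← Finset.mul_sum, ← Finset.sum_mul,
    Finset.prod_univ_sum, Fintype.piFinset_univ]

/-- The edges of the Bell scenario: one from the source and one from the setting per party. -/
def bellEdge {n : ℕ} : Fin n ⊕ Fin n → EdgeT (BellEdges n) :=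
  Sum.elim (fun i => ⟨(.s, .a i), by simp [BellEdges]⟩)
    (fun i => ⟨(.x i, .a i), by simp [BellEdges]⟩)

lemma bellEdge_bijective {n : ℕ} : Function.Bijective (bellEdge (n := n)) := by
  constructor
  · rintro (i | i) (j | j) h <;> simpa [bellEdge] using congrArg Subtype.val h
  · rintro ⟨⟨u, v⟩, h⟩
    obtain ⟨i, hi⟩ : ∃ i, (u, v) = (BellNode.s, BellNode.a i) ∨
        (u, v) = (BellNode.x i, BellNode.a i) := by simpa [BellEdges] using h
    rcases hi with hi | hi
    · exact ⟨.inl i, Subtype.ext hi.symm⟩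
    · exact ⟨.inr i, Subtype.ext hi.symm⟩

lemma IsClassicalFinHV.exists_factors {n : ℕ} {O : BellNode n → Type} [∀ v, Fintype (O v)]
    {P : (∀ v, O v) → ℝ} (h : IsClassicalFinHV (BellEdges n) P) :
    ∃ (S T : Fin n → Type) (_ : ∀ i, Fintype (S i)) (_ : ∀ i, Fintype (T i))
      (_ : ∀ i, Nonempty (S i)) (q : O .s → (∀ i, S i) → ℝ) (r : ∀ i, O (.x i) → T i → ℝ)
      (w : ∀ i, O (.a i) → S i → T i → ℝ),
      (∀ os σ, 0 ≤ q os σ) ∧ (∀ i ox t, 0 ≤ r i ox t) ∧ (∀ i oa s t, 0 ≤ w i oa s t) ∧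
      (∀ i s t, ∑ oa, w i oa s t = 1) ∧
      ∀ o, P o = ∑ σ, q (o .s) σ * ∏ i, ∑ t, r i (o (.x i)) t * w i (o (.a i)) (σ i) t := by
  obtain ⟨X, iX, hX, p, hp0, hp1, hP⟩ := h
  let φ := Equiv.ofBijective _ (bellEdge_bijective (n := n))
  let Λ : (∀ i, X (φ (.inl i))) × (∀ i, X (φ (.inr i))) ≃ ∀ e, X e :=
    (Equiv.sumPiEquivProdPi fun j => X (φ j)).symm.trans (Equiv.piCongrLeft X φ)
  have hΛl : ∀ f i, Λ f (φ (.inl i)) = f.1 i := fun f i =>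
    Equiv.piCongrLeft_apply_apply X φ _ (.inl i)
  have hΛr : ∀ f i, Λ f (φ (.inr i)) = f.2 i := fun f i =>
    Equiv.piCongrLeft_apply_apply X φ _ (.inr i)
  let F : ∀ v, O v → (∀ e, X e) → ℝ := fun v o lam =>
    p v o (fun e => lam e.1) (fun e => lam e.1)
  have hF0 : ∀ v o lam, 0 ≤ F v o lam := fun v o lam => hp0 _ _ _ _
  have hF : ∀ v o f g, (∀ j, ((φ j).1.1 = v ∨ (φ j).1.2 = v) → Λ f (φ j) = Λ g (φ j)) →
      F v o (Λ f) = F v o (Λ g) := by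
    intro v o f g h
    have h' : ∀ e : EdgeT (BellEdges n), (e.1.1 = v ∨ e.1.2 = v) → Λ f e = Λ g e := by
      intro e he
      obtain ⟨j, rfl⟩ := φ.surjective e
      exact h j he
    have h1 : (fun e : {e : EdgeT (BellEdges n) // e.1.1 = v} => Λ f e.1) =
        fun e : {e : EdgeT (BellEdges n) // e.1.1 = v} => Λ g e.1 :=
      funext fun e => h' e.1 (.inl e.2)
    have h2 : (fun e : {e : EdgeT (BellEdges n) // e.1.2 = v} => Λ f e.1) =
        fun e : {e : EdgeT (BellEdges n) // e.1.2 = v} => Λ g e.1 :=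
      funext fun e => h' e.1 (.inr e.2)
    simp only [F, h1, h2]
  let σ₀ : ∀ i, X (φ (.inl i)) := fun i => Classical.arbitrary _
  let τ₀ : ∀ i, X (φ (.inr i)) := fun i => Classical.arbitrary _
  refine ⟨fun i => X (φ (.inl i)), fun i => X (φ (.inr i)), fun i => iX _, fun i => iX _,
    fun i => hX _, fun os σ => F .s os (Λ (σ, τ₀)),
    fun i ox t => F (.x i) ox (Λ (σ₀, Function.update τ₀ i t)),
    fun i oa s t => F (.a i) oa (Λ (Function.update σ₀ i s, Function.update τ₀ i t)),
    fun _ _ => hF0 _ _ _, fun _ _ _ => hF0 _ _ _, fun _ _ _ _ => hF0 _ _ _,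
    fun i s t => ?_, fun o => ?_⟩
  · have : IsEmpty {e : EdgeT (BellEdges n) // e.1.1 = BellNode.a i} := by
      refine ⟨fun ⟨e, he⟩ => ?_⟩
      obtain ⟨j | j, rfl⟩ := φ.surjective e <;> simp [φ, bellEdge] at he
    rw [← hp1 (.a i) fun e => Λ (Function.update σ₀ i s, Function.update τ₀ i t) e.1]
    refine Finset.sum_congr rfl fun oa _ => ?_
    set lam := Λ (Function.update σ₀ i s, Function.update τ₀ i t)
    exact (Fintype.sum_subsingleton (fun μ => p (.a i) oa μ fun e => lam e.1)
      fun e : {e : EdgeT (BellEdges n) // e.1.1 = .a i} => lam e.1).symm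
  · rw [hP, ← Λ.sum_comp, Fintype.sum_prod_type]
    refine Finset.sum_congr rfl fun σ _ => ?_
    rw [Finset.prod_univ_sum, Fintype.piFinset_univ, Finset.mul_sum]
    refine Finset.sum_congr rfl fun τ _ => ?_
    rw [BellNode.prod_eq, ← Finset.prod_mul_distrib]
    congr 1
    · refine hF _ _ _ _ ?_
      rintro (j | j) hj
      · simp only [hΛl]
      · simp [φ, bellEdge] at hj
    · refine Finset.prod_congr rfl fun i _ => ?_
      congr 1
      · refine hF _ _ _ _ ?_
        rintro (j | j) hj
        · simp [φ, bellEdge] at hj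
        · obtain rfl : j = i := by simpa [φ, bellEdge] using hj
          simp [hΛr]
      · refine hF _ _ _ _ ?_
        rintro (j | j) hj
        · obtain rfl : j = i := by simpa [φ, bellEdge] using hj
          simp [hΛl]
        · obtain rfl : j = i := by simpa [φ, bellEdge] using hj
          simp [hΛr]

lemma IsClassicalFinHV.exists_local_model {n : ℕ} {O : BellNode n → Type}
    [∀ v, Fintype (O v)] [∀ v, Nonempty (O v)] {P : (∀ v, O v) → ℝ}
    (hP1 : ∑ o, P o = 1) (h : IsClassicalFinHV (BellEdges n) P) :
    ∃ (S : Fin n → Type) (_ : ∀ i, Fintype (S i)) (_ : ∀ i, Nonempty (S i))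
      (K : O .s → (∀ i, S i) → ℝ) (W : ∀ i, O (.x i) → S i → O (.a i) → ℝ),
      (∀ os σ, 0 ≤ K os σ) ∧ (∀ os, ∑ σ, K os σ = 1) ∧
      (∀ i ox s oa, 0 ≤ W i ox s oa) ∧ (∀ i ox s, ∑ oa, W i ox s oa = 1) ∧
      ∀ o, P o = (∑ σ, K (o .s) σ * ∏ i, W i (o (.x i)) (σ i) (o (.a i))) *
        (∏ i, marginal P {.x i} o) * marginal P {.s} o := by
  obtain ⟨S, T, _, _, _, q, r, w, hq, hr, hw, hw1, hP⟩ := h.exists_factors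
  obtain ⟨K, hK0, hK1, hK⟩ := exists_conditional q hq
  have hc := fun i => exists_conditional
    (fun (a : O (.x i) × S i) oa => ∑ t, r i a.1 t * w i oa a.2 t)
    fun a oa => Finset.sum_nonneg fun t _ => mul_nonneg (hr i a.1 t) (hw i oa a.2 t)
  choose W hW0 hW1 hW using hc
  have hR : ∀ i (ox : O (.x i)) s, ∑ oa, ∑ t, r i ox t * w i oa s t = ∑ t, r i ox t := by
    intro i ox s
    rw [Finset.sum_comm]
    simp_rw [← Finset.mul_sum, hw1, mul_one]
  simp only [hR] at hW
  set Q : O .s → ℝ := fun os => ∑ σ, q os σ with hQdef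
  set R : ∀ i, O (.x i) → ℝ := fun i ox => ∑ t, r i ox t with hRdef
  let L : (∀ v, O v) → ℝ := fun o => ∑ σ, K (o .s) σ * ∏ i, W i (o (.x i), σ i) (o (.a i))
  have hPL : ∀ o, P o = Q (o .s) * (∏ i, R i (o (.x i))) * L o := by
    intro o
    simp only [L]
    rw [hP, Finset.mul_sum]
    refine Finset.sum_congr rfl fun σ _ => ?_
    rw [hK, Finset.prod_congr rfl fun i _ => hW i (o (.x i), σ i) (o (.a i)),
      Finset.prod_mul_distrib]
    ring
  have hsum : ∀ (Q' : O .s → ℝ) (R' : ∀ i, O (.x i) → ℝ),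
      ∑ o, Q' (o .s) * (∏ i, R' i (o (.x i))) * L o = (∑ os, Q' os) * ∏ i, ∑ ox, R' i ox :=
    fun Q' R' => sum_bell_eq Q' R' K hK1 (fun i ox s oa => W i (ox, s) oa)
      fun i ox s => hW1 i (ox, s)
  have htot : (∑ os, Q os) * ∏ i, ∑ ox, R i ox = 1 := by
    rw [← hsum, ← hP1]
    exact Finset.sum_congr rfl fun o _ => (hPL o).symm
  have hms : ∀ o, marginal P {.s} o = Q (o .s) * ∏ i, ∑ ox, R i ox := by
    classical
    intro o
    have := hsum (fun os => if os = o .s then Q os else 0) R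
    rw [Finset.sum_ite_eq' Finset.univ, if_pos (Finset.mem_univ _)] at this
    rw [← this]
    refine Finset.sum_congr rfl fun o' _ => ?_
    by_cases h : o' .s = o .s <;> simp [h, hPL]
  have hmx : ∀ i o, marginal P {.x i} o * ∑ ox, R i ox = R i (o (.x i)) := by
    classical
    intro i o
    have := hsum Q (Function.update R i fun ox => if ox = o (.x i) then R i ox else 0)
    rw [← Finset.mul_prod_erase _ _ (Finset.mem_univ i)] at this htot
    rw [Function.update_self, Finset.sum_ite_eq' Finset.univ, if_pos (Finset.mem_univ _),
      Finset.prod_congr rfl fun j hj => by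
        rw [Function.update_of_ne (Finset.ne_of_mem_erase hj)]] at this
    have hm : marginal P {.x i} o =
        (∑ os, Q os) * (R i (o (.x i)) * ∏ j ∈ Finset.univ.erase i, ∑ ox, R j ox) := by
      rw [← this]
      refine Finset.sum_congr rfl fun o' _ => ?_
      rw [← Finset.mul_prod_erase _ _ (Finset.mem_univ i), Function.update_self,
        Finset.prod_congr rfl fun j hj => by
          rw [Function.update_of_ne (Finset.ne_of_mem_erase hj)]]
      by_cases h : o' (.x i) = o (.x i)
      · simp only [Set.mem_singleton_iff, forall_eq, h, if_true, hPL]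
        rw [← Finset.mul_prod_erase _ _ (Finset.mem_univ i), h]
      · simp [h]
    rw [hm]
    linear_combination R i (o (.x i)) * htot
  refine ⟨S, inferInstance, inferInstance, K, fun i ox s oa => W i (ox, s) oa, hK0, hK1,
    fun i ox s oa => hW0 _ _ _, fun i ox s => hW1 _ _, fun o => ?_⟩
  rw [hms, hPL, Finset.prod_congr rfl fun i _ => (hmx i o).symm, Finset.prod_mul_distrib]
  simp only [L]
  ring

lemma star_dotProduct_prod_diagonal_mulVec {ι : Type*} [Fintype ι] [DecidableEq ι]
    {B : ι → Type*} [∀ i, Fintype (B i)] [∀ i, DecidableEq (B i)] (d : ∀ i, B i → ℂ)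
    (ψ : (∀ i, B i) → ℂ) :
    dotProduct (star ψ) (Matrix.mulVec (Matrix.of fun b b' : ∀ i, B i =>
      ∏ i, Matrix.diagonal (d i) (b i) (b' i)) ψ) = ∑ b, star (ψ b) * ψ b * ∏ i, d i (b i) := by
  have hdiag : (Matrix.of fun b b' : ∀ i, B i => ∏ i, Matrix.diagonal (d i) (b i) (b' i)) =
      Matrix.diagonal fun b => ∏ i, d i (b i) := by
    ext b b'
    by_cases h : b = b'
    · subst h
      simp
    · obtain ⟨i, hi⟩ := Function.ne_iff.1 h
      rw [Matrix.diagonal_apply_ne _ h]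
      exact Finset.prod_eq_zero (Finset.mem_univ i) (Matrix.diagonal_apply_ne _ hi)
  simp only [hdiag, dotProduct, Matrix.mulVec_diagonal, Pi.star_apply]
  exact Finset.sum_congr rfl fun b _ => by ring

open scoped ComplexOrder in
theorem statement_12 {n : ℕ} {O : BellNode n → Type}
    [∀ v, Fintype (O v)] [∀ v, Nonempty (O v)]
    (P : ((v : BellNode n) → O v) → ℝ) (hP0 : ∀ o, 0 ≤ P o) (hP1 : ∑ o, P o = 1)
    (hcl : IsClassicalFinHV (BellEdges n) P) :
    ∃ (m : Fin n → ℕ), (∀ i, 1 ≤ m i) ∧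
      ∃ (ψ : O BellNode.s → ((i : Fin n) → Fin (m i)) → ℂ)
        (Eop : (i : Fin n) → O (BellNode.x i) → O (BellNode.a i) →
          Matrix (Fin (m i)) (Fin (m i)) ℂ),
        (∀ os, dotProduct (star (ψ os)) (ψ os) = 1) ∧
        (∀ i ox oa, (Eop i ox oa).PosSemidef) ∧
        (∀ i ox, ∑ oa, Eop i ox oa = 1) ∧
        (∀ o : (v : BellNode n) → O v,
          (P o : ℂ) =
            (dotProduct (star (ψ (o BellNode.s)))
              (Matrix.mulVec
                (Matrix.of fun b b' : (i : Fin n) → Fin (m i) =>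
                  ∏ i, Eop i (o (BellNode.x i)) (o (BellNode.a i)) (b i) (b' i))
                (ψ (o BellNode.s))))
            * (∏ i, (marginal P {BellNode.x i} o : ℂ))
            * (marginal P {BellNode.s} o : ℂ)) := by
  obtain ⟨S, _, _, K, W, hK0, hK1, hW0, hW1, hP⟩ := hcl.exists_local_model hP1
  let ε : ∀ i, Fin (Fintype.card (S i)) ≃ S i := fun i => (Fintype.equivFin (S i)).symm
  let ψ : O .s → (∀ i, Fin (Fintype.card (S i))) → ℂ := fun os b =>
    (Real.sqrt (K os (Equiv.piCongrRight ε b)) : ℂ)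
  have hψ : ∀ os b, star (ψ os b) * ψ os b = (K os (Equiv.piCongrRight ε b) : ℂ) := by
    intro os b
    simp only [ψ, RCLike.star_def, Complex.conj_ofReal]
    rw [← Complex.ofReal_mul, Real.mul_self_sqrt (hK0 _ _)]
  refine ⟨fun i => Fintype.card (S i), fun i => Fintype.card_pos, ψ,
    fun i ox oa => Matrix.diagonal fun k => (W i ox (ε i k) oa : ℂ), fun os => ?_,
    fun i ox oa => ?_, fun i ox => ?_, fun o => ?_⟩
  · simp only [dotProduct, Pi.star_apply, hψ]
    rw [(Equiv.piCongrRight ε).sum_comp fun σ => (K os σ : ℂ)]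
    exact_mod_cast hK1 os
  · exact Matrix.PosSemidef.diagonal fun k => by simpa using hW0 _ _ _ _
  · ext k l
    rw [Matrix.sum_apply]
    by_cases h : k = l
    · subst h
      simp only [Matrix.diagonal_apply_eq, Matrix.one_apply_eq]
      exact_mod_cast hW1 i ox (ε i k)
    · simp [h]
  · rw [star_dotProduct_prod_diagonal_mulVec
      (fun i k => (W i (o (.x i)) (ε i k) (o (.a i)) : ℂ)) (ψ (o .s))]
    simp only [hψ]
    have hsum := (Equiv.piCongrRight ε).sum_comp fun σ =>
      (K (o .s) σ : ℂ) * ∏ i, (W i (o (.x i)) (σ i) (o (.a i)) : ℂ)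
    simp only [Equiv.piCongrRight_apply, Pi.map_apply] at hsum ⊢
    rw [hsum]
    exact_mod_cast hP o
end
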